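/- arXiv:1601.03535 — 3 statements merged into one kernel-verified Lean document; each statement's English description precedes it below -/
import Mathlib

section
/- Let K ⊂ ℝ^d be a nonempty closed convex set, let b : ℝ^d → ℝ^d and σ : ℝ^d → M_{d,e}(ℝ) be Lipschitz continuous, and let v : [0,T] → ℝ^e be bounded and measurable. Assume that for every x ∈ K and every k ∈ {1,…,e}, one has b(x) ∈ T_K(x), σ_{·,k}(x) ∈ T_K(x) and −σ_{·,k}(x) ∈ T_K(x). Then every continuous y : [0,T] → ℝ^d with y_0 ∈ K and y_t = y_0 + ∫₀ᵗ (b(y_s) + σ(y_s)v_s) ds for all t ∈ [0,T] satisfies y_t ∈ K for every t ∈ [0,T]. -/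
open Filter Topology

noncomputable section

/-- Tangent cone to `S` at `x` (Bouligand, sequential definition). -/
def tangentConePaper {d : ℕ} (S : Set (EuclideanSpace ℝ (Fin d))) (x : EuclideanSpace ℝ (Fin d)) :
    Set (EuclideanSpace ℝ (Fin d)) :=
  {δ | ∃ (xn : ℕ → EuclideanSpace ℝ (Fin d)) (tn : ℕ → ℝ),
    (∀ n, xn n ∈ S) ∧ (∀ n, 0 < tn n) ∧
    Tendsto tn atTop (𝓝 0) ∧ Tendsto xn atTop (𝓝 x) ∧
    Tendsto (fun n => (tn n)⁻¹ • (xn n - x)) atTop (𝓝 δ)}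

theorem tc_inner_nonpos {d : ℕ} {K : Set (EuclideanSpace ℝ (Fin d))}
    {p n δ : EuclideanSpace ℝ (Fin d)} (hn : ∀ z ∈ K, inner ℝ n (z - p) ≤ 0)
    (h : δ ∈ tangentConePaper K p) : inner ℝ n δ ≤ 0 := by
  obtain ⟨xn, tn, h1, h2, -, -, h3⟩ := h
  have h4 : Tendsto (fun m => inner ℝ n ((tn m)⁻¹ • (xn m - p))) atTop (𝓝 (inner ℝ n δ)) :=
    tendsto_const_nhds.inner h3
  refine le_of_tendsto' h4 fun m => ?_
  rw [inner_smul_right]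
  exact mul_nonpos_of_nonneg_of_nonpos (inv_nonneg.2 (h2 m).le) (hn _ (h1 m))

theorem field_inner_le {d e : ℕ} {K : Set (EuclideanSpace ℝ (Fin d))}
    {b : EuclideanSpace ℝ (Fin d) → EuclideanSpace ℝ (Fin d)}
    {σ : EuclideanSpace ℝ (Fin d) → Fin e → EuclideanSpace ℝ (Fin d)}
    {Lb : NNReal} (hb : LipschitzWith Lb b)
    {Lσ : NNReal} (hσ : ∀ k, LipschitzWith Lσ (fun x => σ x k))
    {M : ℝ} {w : EuclideanSpace ℝ (Fin e)} (hw : ‖w‖ ≤ M)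
    {p n x : EuclideanSpace ℝ (Fin d)} (hn : ∀ z ∈ K, inner ℝ n (z - p) ≤ 0)
    (htan : b p ∈ tangentConePaper K p ∧
      ∀ k : Fin e, σ p k ∈ tangentConePaper K p ∧ -σ p k ∈ tangentConePaper K p) :
    inner ℝ n (b x + ∑ k, w k • σ x k) ≤ (Lb + e * (M * Lσ)) * ‖n‖ * ‖x - p‖ := by
  have hM : 0 ≤ M := (norm_nonneg _).trans hw
  have h1 : inner ℝ n (b x) ≤ Lb * ‖n‖ * ‖x - p‖ := by
    have e1 : b x = b p + (b x - b p) := by abel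
    rw [e1, inner_add_right]
    have e2 := tc_inner_nonpos hn htan.1
    have e3 := real_inner_le_norm n (b x - b p)
    have e4 := hb.norm_sub_le x p
    have e5 := mul_le_mul_of_nonneg_left e4 (norm_nonneg n)
    linarith
  have h2 : ∀ k, inner ℝ n (w k • σ x k) ≤ M * Lσ * ‖n‖ * ‖x - p‖ := by
    intro k
    have e0 : inner ℝ n (σ p k) = 0 := by
      have a1 := tc_inner_nonpos hn (htan.2 k).1
      have a2 := tc_inner_nonpos hn (htan.2 k).2
      rw [inner_neg_right] at a2
      linarith
    have e1 : w k • σ x k = w k • σ p k + w k • (σ x k - σ p k) := by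
      rw [← smul_add]; congr 1; abel
    rw [e1, inner_add_right, inner_smul_right, e0, mul_zero, zero_add]
    have e3 := real_inner_le_norm n (w k • (σ x k - σ p k))
    have e4 : ‖σ x k - σ p k‖ ≤ Lσ * ‖x - p‖ := (hσ k).norm_sub_le x p
    have e6 : ‖w k‖ ≤ M := (PiLp.norm_apply_le w k).trans hw
    rw [norm_smul] at e3
    have e5 := mul_le_mul_of_nonneg_left (mul_le_mul e6 e4 (norm_nonneg _) hM) (norm_nonneg n)
    linarith
  rw [inner_add_right, inner_sum]
  have h3 := Finset.sum_le_sum (s := Finset.univ) fun k _ => h2 k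
  rw [Finset.sum_const, Finset.card_univ, Fintype.card_fin, nsmul_eq_mul] at h3
  linarith

theorem invariance_convex
    {d e : ℕ} (hd : 0 < d) (he : 0 < e) {T : ℝ} (hT : 0 < T)
    (K : Set (EuclideanSpace ℝ (Fin d))) (hK : K.Nonempty) (hKc : IsClosed K)
    (hKconv : Convex ℝ K)
    (b : EuclideanSpace ℝ (Fin d) → EuclideanSpace ℝ (Fin d))
    (σ : EuclideanSpace ℝ (Fin d) → Fin e → EuclideanSpace ℝ (Fin d))
    (Lb : NNReal) (hb : LipschitzWith Lb b)
    (Lσ : NNReal) (hσ : ∀ k, LipschitzWith Lσ (fun x => σ x k))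
    (v : ℝ → EuclideanSpace ℝ (Fin e)) (hv : Measurable v)
    (M : ℝ) (hvM : ∀ t ∈ Set.Icc (0:ℝ) T, ‖v t‖ ≤ M)
    (htan : ∀ x ∈ K, b x ∈ tangentConePaper K x ∧
      ∀ k : Fin e, σ x k ∈ tangentConePaper K x ∧ -σ x k ∈ tangentConePaper K x)
    (y : ℝ → EuclideanSpace ℝ (Fin d)) (hy : ContinuousOn y (Set.Icc 0 T))
    (hy0 : y 0 ∈ K)
    (hsol : ∀ t ∈ Set.Icc (0:ℝ) T,
      y t = y 0 + ∫ s in (0:ℝ)..t, (b (y s) + ∑ k, v s k • σ (y s) k)) :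
    ∀ t ∈ Set.Icc (0:ℝ) T, y t ∈ K := by
  have hM : 0 ≤ M := (norm_nonneg _).trans (hvM 0 ⟨le_rfl, hT.le⟩)
  set f : ℝ → EuclideanSpace ℝ (Fin d) := fun s => b (y s) + ∑ k, v s k • σ (y s) k with hf
  have hby : ContinuousOn (fun s => b (y s)) (Set.Icc 0 T) := hb.continuous.comp_continuousOn hy
  have hσy : ∀ k, ContinuousOn (fun s => σ (y s) k) (Set.Icc 0 T) :=
    fun k => (hσ k).continuous.comp_continuousOn hy
  -- bound on the velocity
  obtain ⟨N, hN⟩ : ∃ N, ∀ s ∈ Set.Icc (0:ℝ) T, ‖f s‖ ≤ N := by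
    obtain ⟨B, hB⟩ := isCompact_Icc.exists_bound_of_continuousOn hby
    choose S hS using fun k => isCompact_Icc.exists_bound_of_continuousOn (hσy k)
    refine ⟨B + ∑ k, M * S k, fun s hs => ?_⟩
    refine (norm_add_le _ _).trans (add_le_add (hB s hs) ?_)
    refine (norm_sum_le _ _).trans (Finset.sum_le_sum fun k _ => ?_)
    rw [norm_smul]
    exact mul_le_mul ((PiLp.norm_apply_le (v s) k).trans (hvM s hs)) (hS k s hs)
      (norm_nonneg _) hM
  have hN0 : 0 ≤ N := (norm_nonneg _).trans (hN 0 ⟨le_rfl, hT.le⟩)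
  have hfint : MeasureTheory.IntegrableOn f (Set.Icc 0 T) := by
    refine MeasureTheory.IntegrableOn.of_bound measure_Icc_lt_top ?_ N ?_
    · refine (hby.aestronglyMeasurable measurableSet_Icc).add ?_
      refine Finset.aestronglyMeasurable_fun_sum _ fun k _ => ?_
      have : Measurable fun s => v s k := by fun_prop
      exact this.aestronglyMeasurable.smul ((hσy k).aestronglyMeasurable measurableSet_Icc)
    · exact MeasureTheory.ae_restrict_of_forall_mem measurableSet_Icc hN
  have hii : ∀ s ∈ Set.Icc (0:ℝ) T, ∀ t ∈ Set.Icc (0:ℝ) T,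
      IntervalIntegrable f MeasureTheory.volume s t := fun s hs t ht =>
    (hfint.mono_set (Set.uIcc_subset_Icc hs ht)).intervalIntegrable
  have h0 : (0:ℝ) ∈ Set.Icc (0:ℝ) T := ⟨le_rfl, hT.le⟩
  have hinc : ∀ s ∈ Set.Icc (0:ℝ) T, ∀ t ∈ Set.Icc (0:ℝ) T, y t - y s = ∫ r in s..t, f r := by
    intro s hs t ht
    rw [hsol t ht, hsol s hs, add_sub_add_left_eq_sub]
    exact intervalIntegral.integral_interval_sub_left (hii 0 h0 t ht) (hii 0 h0 s hs)
  have hlip : ∀ s ∈ Set.Icc (0:ℝ) T, ∀ t ∈ Set.Icc (0:ℝ) T, s ≤ t →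
      ‖y t - y s‖ ≤ N * (t - s) := by
    intro s hs t ht hst
    rw [hinc s hs t ht]
    have := intervalIntegral.norm_integral_le_of_norm_le_const (f := f) (a := s) (b := t) (C := N)
      (fun r hr => hN r (by
        rw [Set.uIoc_of_le hst] at hr
        exact ⟨hs.1.trans hr.1.le, hr.2.trans ht.2⟩))
    rwa [abs_of_nonneg (sub_nonneg.2 hst)] at this
  set C : ℝ := Lb + e * (M * Lσ) with hC
  have hC0 : 0 ≤ C := by positivity
  set φ : ℝ → ℝ := fun t => Metric.infDist (y t) K ^ 2 with hφ
  have hφc : ContinuousOn φ (Set.Icc 0 T) :=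
    ((Metric.continuous_infDist_pt K).comp_continuousOn hy).pow 2
  have key : ∀ s ∈ Set.Ico (0:ℝ) T, ∃ A : ℝ, ∀ t ∈ Set.Icc (0:ℝ) T, s < t →
      (t - s)⁻¹ * (φ t - φ s) ≤ 2 * C * φ s + A * (t - s) := by
    intro s hs'
    have hs : s ∈ Set.Icc (0:ℝ) T := ⟨hs'.1, hs'.2.le⟩
    obtain ⟨p, hpK, hp⟩ :=
      exists_norm_eq_iInf_of_complete_convex hK hKc.isComplete hKconv (y s)
    have hn := (norm_eq_iInf_iff_real_inner_le_zero hKconv hpK).1 hp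
    have hps : φ s = ‖y s - p‖ ^ 2 := by
      simp only [hφ, hp, Metric.infDist_eq_iInf, dist_eq_norm]
    set n := y s - p with hndef
    refine ⟨2 * C * ‖n‖ * N + N ^ 2, fun t ht hst => ?_⟩
    have hts : 0 < t - s := sub_pos.2 hst
    have h1 : φ t ≤ ‖y t - p‖ ^ 2 := by
      have := Metric.infDist_le_dist_of_mem (x := y t) hpK
      rw [dist_eq_norm] at this
      exact pow_le_pow_left₀ Metric.infDist_nonneg this 2
    have h2 : ‖y t - p‖ ^ 2 = ‖n‖ ^ 2 + 2 * inner ℝ n (y t - y s) + ‖y t - y s‖ ^ 2 := by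
      rw [← norm_add_sq_real]; congr 2; rw [hndef]; abel
    have h3 : inner ℝ n (y t - y s) ≤ (t - s) * (C * ‖n‖ * (‖n‖ + N * (t - s))) := by
      rw [hinc s hs t ht]
      have e1 : inner ℝ n (∫ r in s..t, f r) = ∫ r in s..t, inner ℝ n (f r) :=
        ((innerSL ℝ n).intervalIntegral_comp_comm (hii s hs t ht)).symm
      have e2 : IntervalIntegrable (fun r => inner ℝ n (f r)) MeasureTheory.volume s t :=
        ⟨(innerSL ℝ n).integrable_comp (hii s hs t ht).1,
          (innerSL ℝ n).integrable_comp (hii s hs t ht).2⟩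
      rw [e1]
      calc _ ≤ ∫ r in s..t, C * ‖n‖ * (‖n‖ + N * (t - s)) := by
            refine intervalIntegral.integral_mono_on hst.le e2 (by simp) fun r hr => ?_
            have hr' : r ∈ Set.Icc (0:ℝ) T := ⟨hs.1.trans hr.1, hr.2.trans ht.2⟩
            refine (field_inner_le hb hσ (hvM r hr') hn (htan p hpK)).trans ?_
            refine mul_le_mul_of_nonneg_left ?_ (by positivity)
            have e3 : y r - p = n + (y r - y s) := by rw [hndef]; abel
            rw [e3]
            refine (norm_add_le _ _).trans ?_
            have e4 := hlip s hs r hr' hr.1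
            have e5 : N * (r - s) ≤ N * (t - s) :=
              mul_le_mul_of_nonneg_left (by linarith [hr.2]) hN0
            linarith
        _ = _ := by rw [intervalIntegral.integral_const, smul_eq_mul]
    have h4 : ‖y t - y s‖ ^ 2 ≤ (N * (t - s)) ^ 2 :=
      pow_le_pow_left₀ (norm_nonneg _) (hlip s hs t ht hst.le) 2
    rw [inv_mul_le_iff₀ hts, hps]
    nlinarith
  have main : ∀ t ∈ Set.Icc (0:ℝ) T, φ t ≤ gronwallBound 0 (2 * C) 0 (t - 0) := by
    refine le_gronwallBound_of_liminf_deriv_right_le (f' := fun s => 2 * C * φ s) hφc ?_ ?_ ?_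
    · intro s hs r hr
      obtain ⟨A, hA⟩ := key s hs
      have lim : Tendsto (fun t => 2 * C * φ s + A * (t - s)) (𝓝[>] s) (𝓝 (2 * C * φ s)) := by
        have : Continuous fun t : ℝ => 2 * C * φ s + A * (t - s) := by fun_prop
        have h := this.tendsto s
        simp only [sub_self, mul_zero, add_zero] at h
        exact h.mono_left nhdsWithin_le_nhds
      have ev := lim.eventually (gt_mem_nhds hr)
      refine Eventually.frequently ?_
      filter_upwards [ev, Ioo_mem_nhdsGT hs.2] with t h1 h2
      exact (hA t ⟨hs.1.trans h2.1.le, h2.2.le⟩ h2.1).trans_lt h1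
    · simp [hφ, Metric.infDist_zero_of_mem hy0]
    · intro s _; simp
  intro t ht
  have h := main t ht
  rw [gronwallBound_ε0_δ0] at h
  have h' : Metric.infDist (y t) K = 0 := pow_eq_zero_iff two_ne_zero |>.1 (le_antisymm h (sq_nonneg _))
  exact (hKc.mem_iff_infDist_zero hK).2 h'
end
end

section
/- Let I ⊂ {1,…,d} be nonempty, let v : [0,T] → ℝ^e be bounded and measurable, and for j ∈ {1,2} let b_j : ℝ^d → ℝ^d and σ^j : ℝ^d → M_{d,e}(ℝ) be Lipschitz continuous. Assume that for every (x_1,x_2) ∈ (ℝ^d)² with x_1^{(i)} ≤ x_2^{(i)} for all i ∈ I and every i ∈ I with x_1^{(i)} = x_2^{(i)}, one has b_1^{(i)}(x_1) ≤ b_2^{(i)}(x_2) and σ^1_{i,k}(x_1) = σ^2_{i,k}(x_2) for every k ∈ {1,…,e}. Then for any continuous solutions y^1, y^2 : [0,T] → ℝ^d of y^j_t = y^j_0 + ∫₀ᵗ (b_j(y^j_s) + σ^j(y^j_s)v_s) ds with (y^1_0)^{(i)} ≤ (y^2_0)^{(i)} for every i ∈ I, one has (y^1_t)^{(i)} ≤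 (y^2_t)^{(i)} for every t ∈ [0,T] and every i ∈ I. -/
open Filter Topology

noncomputable section

open Classical in
lemma gron_aux {T : ℝ} (φ : ℝ → ℝ) (hφ : Continuous φ) (hφ0 : ∀ t, 0 ≤ φ t) (K : ℝ)
    (h : ∀ t ∈ Set.Icc (0:ℝ) T, φ t ≤ K * ∫ s in (0:ℝ)..t, φ s) :
    ∀ t ∈ Set.Icc (0:ℝ) T, φ t ≤ 0 := by
  have hder : ∀ t, HasDerivAt (fun t => ∫ s in (0:ℝ)..t, φ s) (φ t) t := fun t =>
    intervalIntegral.integral_hasDerivAt_right (hφ.intervalIntegrable _ _)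
      hφ.stronglyMeasurable.stronglyMeasurableAtFilter hφ.continuousAt
  have hpos : ∀ t, 0 ≤ t → 0 ≤ ∫ s in (0:ℝ)..t, φ s := fun t ht =>
    intervalIntegral.integral_nonneg ht (fun s _ => hφ0 s)
  intro t ht
  have := norm_le_gronwallBound_of_norm_deriv_right_le (f := fun t => ∫ s in (0:ℝ)..t, φ s)
    (f' := φ) (δ := 0) (K := K) (ε := 0) (a := 0) (b := T)
    (fun t _ => (hder t).continuousAt.continuousWithinAt)
    (fun t _ => (hder t).hasDerivWithinAt) (by simp)
    (fun t ht => by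
      rw [Real.norm_of_nonneg (hφ0 t), Real.norm_of_nonneg (hpos t ht.1), add_zero]
      exact h t ⟨ht.1, ht.2.le⟩) t ht
  rw [gronwallBound_ε0_δ0] at this
  have h1 : (∫ s in (0:ℝ)..t, φ s) = 0 := by simpa using this
  have := h t ht
  rw [h1] at this
  simpa using this

open Classical in
lemma core_aux {d : ℕ} (I : Set (Fin d)) {T : ℝ} (z f : Fin d → ℝ → ℝ)
    (hz : ∀ i, Continuous (z i))
    (hf : ∀ i, IntervalIntegrable (f i) MeasureTheory.volume 0 T)
    (hzf : ∀ i, ∀ t ∈ Set.Icc (0:ℝ) T, z i t = z i 0 + ∫ s in (0:ℝ)..t, f i s)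
    (C : ℝ) (hC : 0 ≤ C)
    (hfC : ∀ s ∈ Set.Icc (0:ℝ) T, ∀ i ∈ I, 0 < z i s →
      f i s ≤ C * ∑ j, if j ∈ I then max (z j s) 0 else 0)
    (h0 : ∀ i ∈ I, z i 0 ≤ 0) :
    ∀ t ∈ Set.Icc (0:ℝ) T, ∀ i ∈ I, z i t ≤ 0 := by
  set φ : ℝ → ℝ := fun s => ∑ j, if j ∈ I then max (z j s) 0 else 0 with hφdef
  have hφ : Continuous φ := by
    refine continuous_finset_sum _ fun j _ => ?_
    split_ifs
    · exact (hz j).max continuous_const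
    · exact continuous_const
  have hφ0 : ∀ t, 0 ≤ φ t := fun t => Finset.sum_nonneg fun j _ => by
    split_ifs
    · exact le_max_right _ _
    · exact le_rfl
  have key : ∀ t ∈ Set.Icc (0:ℝ) T, ∀ i ∈ I, max (z i t) 0 ≤ C * ∫ s in (0:ℝ)..t, φ s := by
    intro t ht i hi
    have hnn : ∀ a b : ℝ, a ≤ b → 0 ≤ ∫ s in a..b, φ s := fun a b hab =>
      intervalIntegral.integral_nonneg hab (fun s _ => hφ0 s)
    refine max_le ?_ (mul_nonneg hC (hnn 0 t ht.1))
    by_cases hzt : z i t ≤ 0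
    · exact hzt.trans (mul_nonneg hC (hnn 0 t ht.1))
    push Not at hzt
    have hcomp : IsCompact (Set.Icc 0 t ∩ {s | z i s ≤ 0}) :=
      isCompact_Icc.inter_right (isClosed_le (hz i) continuous_const)
    obtain ⟨r, ⟨⟨hr0, hrt⟩, hzr⟩, hmax⟩ := hcomp.exists_isMaxOn
      ⟨0, ⟨le_rfl, ht.1⟩, h0 i hi⟩ continuousOn_id
    have hgt : ∀ s, r < s → s ≤ t → 0 < z i s := by
      intro s hrs hst
      by_contra hcon
      have := hmax (show s ∈ Set.Icc 0 t ∩ {s | z i s ≤ 0} from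
        ⟨⟨hr0.trans hrs.le, hst⟩, not_lt.1 hcon⟩)
      simp at this
      linarith
    have hfi : ∀ a b, 0 ≤ a → a ≤ b → b ≤ T →
        IntervalIntegrable (f i) MeasureTheory.volume a b := by
      intro a b h1 h2 h3
      refine (hf i).mono_set ?_
      rw [Set.uIcc_of_le h2, Set.uIcc_of_le (h1.trans (h2.trans h3))]
      exact Set.Icc_subset_Icc h1 h3
    have e1 := hzf i t ht
    have e2 := hzf i r ⟨hr0, hrt.trans ht.2⟩
    have e3 := intervalIntegral.integral_add_adjacent_intervals
      (hfi 0 r le_rfl hr0 (hrt.trans ht.2)) (hfi r t hr0 hrt ht.2)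
    have e4 : ∫ s in r..t, f i s ≤ ∫ s in r..t, C * φ s := by
      refine intervalIntegral.integral_mono_on_of_le_Ioo hrt (hfi r t hr0 hrt ht.2)
        ((hφ.const_mul C).intervalIntegrable _ _) ?_
      intro s hs
      exact hfC s ⟨hr0.trans hs.1.le, hs.2.le.trans ht.2⟩ i hi (hgt s hs.1 hs.2.le)
    rw [intervalIntegral.integral_const_mul] at e4
    have e5 := intervalIntegral.integral_add_adjacent_intervals
      (hφ.intervalIntegrable (μ := MeasureTheory.volume) 0 r) (hφ.intervalIntegrable r t)
    have e6 := mul_nonneg hC (hnn 0 r hr0)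
    have hzr' : z i r ≤ 0 := hzr
    rw [← e5, mul_add]
    linarith
  have hg := gron_aux (T := T) φ hφ hφ0 (d * C) (by
    intro t ht
    have hCI : 0 ≤ C * ∫ s in (0:ℝ)..t, φ s :=
      mul_nonneg hC (intervalIntegral.integral_nonneg ht.1 (fun s _ => hφ0 s))
    calc φ t ≤ ∑ j : Fin d, C * ∫ s in (0:ℝ)..t, φ s := by
          refine Finset.sum_le_sum fun j _ => ?_
          split_ifs with hj
          · exact key t ht j hj
          · exact hCI
      _ = _ := by simp [mul_assoc])
  intro t ht i hi
  have h1 := hg t ht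
  have h2 : (if i ∈ I then max (z i t) 0 else 0) ≤ φ t :=
    Finset.single_le_sum (f := fun j => if j ∈ I then max (z j t) 0 else 0) (fun j _ => by
      split_ifs
      · exact le_max_right _ _
      · exact le_rfl) (Finset.mem_univ i)
  rw [if_pos hi] at h2
  exact (le_max_left _ _).trans (h2.trans h1)

open Classical in
lemma modif_aux {d : ℕ} (I : Set (Fin d)) (x₁ x₂ : EuclideanSpace ℝ (Fin d)) :
    ∃ x : EuclideanSpace ℝ (Fin d), (∀ i ∈ I, x i ≤ x₂ i) ∧
      (∀ i ∈ I, 0 < x₁ i - x₂ i → x i = x₂ i) ∧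
      ‖x₁ - x‖ ≤ ∑ j, if j ∈ I then max (x₁ j - x₂ j) 0 else 0 := by
  set a : Fin d → ℝ := fun j => if j ∈ I then max (x₁ j - x₂ j) 0 else 0 with ha
  have hx : ∀ i, (x₁ - ∑ j, EuclideanSpace.single j (a j)) i = x₁ i - a i := by
    intro i
    simp [Finset.sum_apply]
  refine ⟨x₁ - ∑ j, EuclideanSpace.single j (a j), ?_, ?_, ?_⟩
  · intro i hi
    rw [hx]
    simp only [ha, if_pos hi]
    linarith [le_max_left (x₁ i - x₂ i) 0]
  · intro i hi h
    rw [hx]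
    simp only [ha, if_pos hi, max_eq_left h.le]
    ring
  · rw [sub_sub_cancel]
    refine (norm_sum_le _ _).trans (Finset.sum_le_sum fun j _ => ?_)
    rw [EuclideanSpace.norm_single, Real.norm_of_nonneg]
    simp only [ha]
    split_ifs
    · exact le_max_right _ _
    · exact le_rfl

lemma lip_coord {d : ℕ} {L : NNReal} {g : EuclideanSpace ℝ (Fin d) → EuclideanSpace ℝ (Fin d)}
    (hg : LipschitzWith L g) (x y : EuclideanSpace ℝ (Fin d)) (i : Fin d) :
    |g x i - g y i| ≤ L * ‖x - y‖ := by
  have h1 := PiLp.norm_apply_le (g x - g y) i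
  have h2 := hg.dist_le_mul x y
  rw [dist_eq_norm, dist_eq_norm] at h2
  rw [PiLp.sub_apply, Real.norm_eq_abs] at h1
  exact h1.trans h2

lemma integ_aux {d e : ℕ} {T : ℝ} (hT : 0 < T)
    {b : EuclideanSpace ℝ (Fin d) → EuclideanSpace ℝ (Fin d)}
    {σ : EuclideanSpace ℝ (Fin d) → Fin e → EuclideanSpace ℝ (Fin d)}
    (hb : Continuous b) (hσ : ∀ k, Continuous (fun x => σ x k))
    (v : ℝ → EuclideanSpace ℝ (Fin e)) (hv : Measurable v)
    (M : ℝ) (hvM : ∀ t ∈ Set.Icc (0:ℝ) T, ‖v t‖ ≤ M)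
    (y : ℝ → EuclideanSpace ℝ (Fin d)) (hy : ContinuousOn y (Set.Icc 0 T)) :
    IntervalIntegrable (fun s => b (y s) + ∑ k, v s k • σ (y s) k) MeasureTheory.volume 0 T := by
  have hu : Set.uIcc 0 T = Set.Icc 0 T := Set.uIcc_of_le hT.le
  refine IntervalIntegrable.add ?_ ?_
  · refine ContinuousOn.intervalIntegrable ?_
    rw [hu]
    exact hb.comp_continuousOn hy
  · have : ∀ k : Fin e, IntervalIntegrable (fun s => v s k • σ (y s) k)
        MeasureTheory.volume 0 T := by
      intro k
      have hvk : IntervalIntegrable (fun s => v s k) MeasureTheory.volume 0 T := by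
        rw [intervalIntegrable_iff_integrableOn_Icc_of_le hT.le]
        refine MeasureTheory.Measure.integrableOn_of_bounded (M := M) (by simp) ?_ ?_
        · have : Measurable (fun s => v s k) := by fun_prop
          exact this.aestronglyMeasurable
        · refine (MeasureTheory.ae_restrict_iff' measurableSet_Icc).2 (Eventually.of_forall ?_)
          intro s hs
          exact (PiLp.norm_apply_le (v s) k).trans (hvM s hs)
      refine hvk.smul_continuousOn ?_
      rw [hu]
      exact (hσ k).comp_continuousOn hy
    simp only [intervalIntegrable_iff] at this ⊢
    exact MeasureTheory.integrable_finset_sum _ (fun k _ => this k)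

theorem comparison_theorem
    {d e : ℕ} (hd : 0 < d) (he : 0 < e) {T : ℝ} (hT : 0 < T)
    (I : Set (Fin d)) (hI : I.Nonempty)
    (b₁ b₂ : EuclideanSpace ℝ (Fin d) → EuclideanSpace ℝ (Fin d))
    (σ₁ σ₂ : EuclideanSpace ℝ (Fin d) → Fin e → EuclideanSpace ℝ (Fin d))
    (Lb : NNReal) (hb₁ : LipschitzWith Lb b₁) (hb₂ : LipschitzWith Lb b₂)
    (Lσ : NNReal) (hσ₁ : ∀ k, LipschitzWith Lσ (fun x => σ₁ x k))
    (hσ₂ : ∀ k, LipschitzWith Lσ (fun x => σ₂ x k))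
    (v : ℝ → EuclideanSpace ℝ (Fin e)) (hv : Measurable v)
    (M : ℝ) (hvM : ∀ t ∈ Set.Icc (0:ℝ) T, ‖v t‖ ≤ M)
    (hcmp : ∀ x₁ x₂ : EuclideanSpace ℝ (Fin d), (∀ i ∈ I, x₁ i ≤ x₂ i) →
      ∀ i ∈ I, x₁ i = x₂ i →
        b₁ x₁ i ≤ b₂ x₂ i ∧ ∀ k : Fin e, σ₁ x₁ k i = σ₂ x₂ k i)
    (y₁ y₂ : ℝ → EuclideanSpace ℝ (Fin d))
    (hy₁ : ContinuousOn y₁ (Set.Icc 0 T)) (hy₂ : ContinuousOn y₂ (Set.Icc 0 T))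
    (hsol₁ : ∀ t ∈ Set.Icc (0:ℝ) T,
      y₁ t = y₁ 0 + ∫ s in (0:ℝ)..t, (b₁ (y₁ s) + ∑ k, v s k • σ₁ (y₁ s) k))
    (hsol₂ : ∀ t ∈ Set.Icc (0:ℝ) T,
      y₂ t = y₂ 0 + ∫ s in (0:ℝ)..t, (b₂ (y₂ s) + ∑ k, v s k • σ₂ (y₂ s) k))
    (h0 : ∀ i ∈ I, y₁ 0 i ≤ y₂ 0 i) :
    ∀ t ∈ Set.Icc (0:ℝ) T, ∀ i ∈ I, y₁ t i ≤ y₂ t i := by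
  classical
  set Y₁ : ℝ → EuclideanSpace ℝ (Fin d) := Set.IccExtend hT.le ((Set.Icc 0 T).restrict y₁)
    with hY₁
  set Y₂ : ℝ → EuclideanSpace ℝ (Fin d) := Set.IccExtend hT.le ((Set.Icc 0 T).restrict y₂)
    with hY₂
  have hE₁ : ∀ t ∈ Set.Icc 0 T, Y₁ t = y₁ t := fun t ht => by
    rw [hY₁, Set.IccExtend_of_mem _ _ ht]; rfl
  have hE₂ : ∀ t ∈ Set.Icc 0 T, Y₂ t = y₂ t := fun t ht => by
    rw [hY₂, Set.IccExtend_of_mem _ _ ht]; rfl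
  have hc₁ : Continuous Y₁ := hy₁.restrict.Icc_extend'
  have hc₂ : Continuous Y₂ := hy₂.restrict.Icc_extend'
  have hM : 0 ≤ M := (norm_nonneg _).trans (hvM 0 ⟨le_rfl, hT.le⟩)
  have h0T : (0:ℝ) ∈ Set.Icc 0 T := ⟨le_rfl, hT.le⟩
  set F₁ : ℝ → EuclideanSpace ℝ (Fin d) := fun s => b₁ (y₁ s) + ∑ k, v s k • σ₁ (y₁ s) k with hF₁
  set F₂ : ℝ → EuclideanSpace ℝ (Fin d) := fun s => b₂ (y₂ s) + ∑ k, v s k • σ₂ (y₂ s) k with hF₂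
  have hI₁ : IntervalIntegrable F₁ MeasureTheory.volume 0 T :=
    integ_aux hT hb₁.continuous (fun k => (hσ₁ k).continuous) v hv M hvM y₁ hy₁
  have hI₂ : IntervalIntegrable F₂ MeasureTheory.volume 0 T :=
    integ_aux hT hb₂.continuous (fun k => (hσ₂ k).continuous) v hv M hvM y₂ hy₂
  have hI : IntervalIntegrable (fun s => F₁ s - F₂ s) MeasureTheory.volume 0 T := hI₁.sub hI₂
  have hmono : ∀ {G : ℝ → EuclideanSpace ℝ (Fin d)},
      IntervalIntegrable G MeasureTheory.volume 0 T → ∀ t ∈ Set.Icc (0:ℝ) T,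
      IntervalIntegrable G MeasureTheory.volume 0 t := by
    intro G hG t ht
    refine hG.mono_set ?_
    rw [Set.uIcc_of_le ht.1, Set.uIcc_of_le hT.le]
    exact Set.Icc_subset_Icc le_rfl ht.2
  have main := core_aux I (T := T) (fun i t => Y₁ t i - Y₂ t i)
    (fun i s => (F₁ s - F₂ s) i) (fun i => by fun_prop)
    (fun i => by
      have := hI
      rw [intervalIntegrable_iff] at this ⊢
      exact (EuclideanSpace.proj (𝕜 := ℝ) i).integrable_comp this)
    (fun i t ht => by
      have h1 : ∫ s in (0:ℝ)..t, (F₁ s - F₂ s) i = (∫ s in (0:ℝ)..t, (F₁ s - F₂ s)) i :=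
        (EuclideanSpace.proj (𝕜 := ℝ) i).intervalIntegral_comp_comm (hmono hI t ht)
      have h2 := intervalIntegral.integral_sub (hmono hI₁ t ht) (hmono hI₂ t ht)
      simp only [hE₁ t ht, hE₂ t ht, hE₁ 0 h0T, hE₂ 0 h0T]
      rw [h2] at h1
      have h3 := congrArg (fun x : EuclideanSpace ℝ (Fin d) => x i) (hsol₁ t ht)
      have h4 := congrArg (fun x : EuclideanSpace ℝ (Fin d) => x i) (hsol₂ t ht)
      simp only [PiLp.add_apply] at h3 h4
      simp only [PiLp.sub_apply] at h1 ⊢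
      rw [h1, h3, h4]
      ring)
    (Lb + e * (M * Lσ)) (by positivity)
    (fun s hs i hi hpos => by
      simp only [hE₁ s hs, hE₂ s hs] at hpos ⊢
      obtain ⟨x, hx1, hx2, hx3⟩ := modif_aux I (y₁ s) (y₂ s)
      set φ := ∑ j, if j ∈ I then max (y₁ s j - y₂ s j) 0 else 0
      obtain ⟨c1, c2⟩ := hcmp x (y₂ s) hx1 i hi (hx2 i hi hpos)
      have hb : b₁ (y₁ s) i - b₂ (y₂ s) i ≤ Lb * φ := by
        have h1 := (le_abs_self _).trans (lip_coord hb₁ (y₁ s) x i)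
        have h2 : (Lb:ℝ) * ‖y₁ s - x‖ ≤ Lb * φ := by gcongr
        linarith
      have hs' : ∀ k, v s k * σ₁ (y₁ s) k i - v s k * σ₂ (y₂ s) k i ≤ M * Lσ * φ := by
        intro k
        have h1 := lip_coord (hσ₁ k) (y₁ s) x i
        have h2 : |v s k| ≤ M := (PiLp.norm_apply_le (v s) k).trans (hvM s hs)
        rw [← mul_sub, ← c2 k]
        calc _ ≤ |v s k| * |σ₁ (y₁ s) k i - σ₁ x k i| := by
              rw [← abs_mul]; exact le_abs_self _
          _ ≤ M * (Lσ * φ) := by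
              refine mul_le_mul h2 (h1.trans ?_) (abs_nonneg _) hM
              gcongr
          _ = _ := by ring
      have hsum := Finset.sum_le_sum (s := Finset.univ) (fun k (_ : k ∈ Finset.univ) => hs' k)
      rw [Finset.sum_sub_distrib] at hsum
      simp at hsum
      simp [hF₁, hF₂]
      linarith)
    (fun i hi => by
      simp only [hE₁ 0 h0T, hE₂ 0 h0T]
      linarith [h0 i hi])
  intro t ht i hi
  have := main t ht i hi
  simp only [hE₁ t ht, hE₂ t ht] at this
  linarith
end
end

section
/- Let K ⊂ ℝ^d be a nonempty convex compact set, let b : ℝ^d → ℝ^d and σ : ℝ^d → M_{d,e}(ℝ) be locally Lipschitz continuous, and let v : [0,T] → ℝ^e be bounded and measurable. Assume that for every x ∈ K and every k ∈ {1,…,e}, b(x) ∈ T_K(x), σ_{·,k}(x) ∈ T_K(x) and −σ_{·,k}(x) ∈ T_K(x). Then for every y_0 ∈ K there exists a continuous y : [0,T] → ℝ^d with y_t = y_0 + ∫₀ᵗ (b(y_s) + σ(y_s)v_s) ds for all t ∈ [0,T], and every such solution satisfies y_t ∈ K for every t ∈ [0,T]; in particular no solution starting in K blows up before time T. -/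
open Filter Topology

noncomputable section

open MeasureTheory Set in
theorem viability_aux {E : Type*} [NormedAddCommGroup E] [InnerProductSpace ℝ E] [CompleteSpace E]
    (G : ℝ → E → E) (L : NNReal) (C₀ T : ℝ) (hL : ∀ s, LipschitzWith L (G s))
    (hint : ∀ y : ℝ → E, Continuous y → ∀ a b, IntervalIntegrable (fun s => G s (y s)) volume a b)
    (hC₀ : ∀ s, ‖G s 0‖ ≤ C₀) (K : Set E) (hKconv : Convex ℝ K) (hK : K.Nonempty)
    (hKcomp : IsCompact K)
    (hn : ∀ s, ∀ p ∈ K, ∀ w : E, (∀ q ∈ K, inner ℝ w (q - p) ≤ 0) → inner ℝ w (G s p) ≤ 0)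
    (y : ℝ → E) (hy : Continuous y) (y₀ : E) (hy₀ : y₀ ∈ K)
    (hsol : ∀ t ∈ Icc (0:ℝ) T, y t = y₀ + ∫ s in (0:ℝ)..t, G s (y s)) :
    ∀ t ∈ Icc (0:ℝ) T, y t ∈ K := by
  intro t ht
  have hT : 0 ≤ T := ht.1.trans ht.2
  have h0 : y 0 = y₀ := by simpa using hsol 0 ⟨le_rfl, hT⟩
  obtain ⟨R, hR⟩ := (isCompact_Icc (a := (0:ℝ)) (b := T)).exists_bound_of_continuousOn hy.continuousOn
  set C := C₀ + L * R with hC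
  have hGC : ∀ s ∈ Icc (0:ℝ) T, ‖G s (y s)‖ ≤ C := by
    intro s hs
    have h1 : ‖G s (y s) - G s 0‖ ≤ L * ‖y s - 0‖ := by
      simpa [dist_eq_norm] using (hL s).dist_le_mul (y s) 0
    have h2 : ‖G s (y s)‖ ≤ ‖G s 0‖ + ‖G s (y s) - G s 0‖ := by
      simpa using norm_add_le (G s 0) (G s (y s) - G s 0)
    have h3 : (L:ℝ) * ‖y s - 0‖ ≤ L * R := by
      rw [sub_zero]; exact mul_le_mul_of_nonneg_left (hR s hs) L.2
    linarith [hC₀ s]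
  have hC0 : 0 ≤ C := (norm_nonneg _).trans (hGC 0 ⟨le_rfl, hT⟩)
  have hinc : ∀ x ∈ Icc (0:ℝ) T, ∀ z ∈ Icc (0:ℝ) T, y z - y x = ∫ s in x..z, G s (y s) := by
    intro x hx z hz
    rw [hsol x hx, hsol z hz, ← intervalIntegral.integral_interval_sub_left
      (hint y hy 0 z) (hint y hy 0 x)]
    abel
  have hlip : ∀ x ∈ Icc (0:ℝ) T, ∀ z ∈ Icc (0:ℝ) T, x ≤ z → ‖y z - y x‖ ≤ C * (z - x) := by
    intro x hx z hz hxz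
    rw [hinc x hx z hz, ← abs_of_nonneg (sub_nonneg.2 hxz)]
    refine intervalIntegral.norm_integral_le_of_norm_le_const fun s hs => hGC s ?_
    rw [uIoc_of_le hxz] at hs
    exact ⟨hx.1.trans hs.1.le, hs.2.trans hz.2⟩
  have key : Metric.infDist (y t) K ^ 2 ≤ gronwallBound 0 (2 * L) 0 (t - 0) := by
    refine le_gronwallBound_of_liminf_deriv_right_le
      (f := fun t => Metric.infDist (y t) K ^ 2) (f' := fun t => 2 * L * Metric.infDist (y t) K ^ 2)
      (a := 0) (b := T)
      (((Metric.continuous_infDist_pt K).comp hy).pow 2).continuousOn ?_ ?_ ?_ t ht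
    · intro x hx r hr
      apply Eventually.frequently
      obtain ⟨p, hpK, hp⟩ := hKcomp.exists_infDist_eq_dist hK (y x)
      set w := y x - p with hw
      have hD : Metric.infDist (y x) K = ‖w‖ := by rw [hp, dist_eq_norm]
      have hwn : ∀ q ∈ K, inner ℝ w (q - p) ≤ 0 := by
        rw [hw, ← norm_eq_iInf_iff_real_inner_le_zero hKconv hpK]
        rw [← hw, ← hD, Metric.infDist_eq_iInf]
        simp [dist_eq_norm]
      have hlim : Tendsto (fun z => 2 * L * ‖w‖ ^ 2 + (z - x) * (C ^ 2 + 2 * L * ‖w‖ * C))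
          (𝓝[>] x) (𝓝 (2 * L * ‖w‖ ^ 2 + (x - x) * (C ^ 2 + 2 * L * ‖w‖ * C))) := by
        refine Tendsto.mono_left (Continuous.tendsto ?_ x) nhdsWithin_le_nhds
        fun_prop
      have hr' : 2 * L * ‖w‖ ^ 2 + (x - x) * (C ^ 2 + 2 * L * ‖w‖ * C) < r := by
        rw [← hD]; simpa using hr
      filter_upwards [hlim.eventually_lt_const hr', Ioo_mem_nhdsGT hx.2] with z hz1 hz
      refine lt_of_le_of_lt ?_ hz1
      have hxI : x ∈ Icc 0 T := ⟨hx.1, hx.2.le⟩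
      have hzI : z ∈ Icc 0 T := ⟨hx.1.trans hz.1.le, hz.2.le⟩
      have hzx : 0 < z - x := sub_pos.2 hz.1
      have hinner : inner ℝ w (y z - y x) ≤
          (z - x) * (L * ‖w‖ ^ 2 + L * ‖w‖ * (C * (z - x))) := by
        rw [hinc x hxI z hzI]
        have := (innerSL ℝ w).intervalIntegral_comp_comm (hint y hy x z)
        simp only [innerSL_apply_apply] at this
        rw [← this]
        have hc : (z - x) * (L * ‖w‖ ^ 2 + L * ‖w‖ * (C * (z - x))) =
            ∫ s in x..z, (L * ‖w‖ ^ 2 + L * ‖w‖ * (C * (z - x))) := by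
          rw [intervalIntegral.integral_const, smul_eq_mul]
        rw [hc]
        refine intervalIntegral.integral_mono_on hz.1.le ?_ (by simp) ?_
        · have hh := hint y hy x z
          rw [intervalIntegrable_iff] at hh ⊢
          exact (innerSL ℝ w).integrable_comp hh
        · intro s hs
          have hsI : s ∈ Icc 0 T := ⟨hx.1.trans hs.1, hs.2.trans hz.2.le⟩
          have e1 : G s (y s) = G s p + (G s (y s) - G s p) := by abel
          rw [e1, inner_add_right]
          have e2 := hn s p hpK w hwn
          have e3 : ‖G s (y s) - G s p‖ ≤ L * ‖y s - p‖ := by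
            simpa [dist_eq_norm] using (hL s).dist_le_mul (y s) p
          have e4 : ‖y s - p‖ ≤ ‖w‖ + C * (z - x) := by
            have : y s - p = w + (y s - y x) := by rw [hw]; abel
            rw [this]
            refine (norm_add_le _ _).trans (add_le_add_right ?_ _)
            refine (hlip x hxI s hsI hs.1).trans (mul_le_mul_of_nonneg_left ?_ hC0)
            linarith [hs.2]
          have e5 := real_inner_le_norm w (G s (y s) - G s p)
          have e6 : ‖w‖ * ‖G s (y s) - G s p‖ ≤ ‖w‖ * (L * (‖w‖ + C * (z - x))) :=
            mul_le_mul_of_nonneg_left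
              (e3.trans (mul_le_mul_of_nonneg_left e4 L.2)) (norm_nonneg _)
          nlinarith
      have hDz : Metric.infDist (y z) K ^ 2 ≤ ‖y z - p‖ ^ 2 := by
        rw [← dist_eq_norm]
        exact pow_le_pow_left₀ Metric.infDist_nonneg (Metric.infDist_le_dist_of_mem hpK) 2
      have e : y z - p = w + (y z - y x) := by rw [hw]; abel
      rw [e, norm_add_sq_real] at hDz
      have hsq : ‖y z - y x‖ ^ 2 ≤ (C * (z - x)) ^ 2 :=
        pow_le_pow_left₀ (norm_nonneg _) (hlip x hxI z hzI hz.1.le) 2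
      rw [inv_mul_le_iff₀ hzx, hD]
      nlinarith
    · simp [h0, Metric.infDist_zero_of_mem hy₀]
    · intro x _; simp
  rw [gronwallBound_ε0_δ0] at key
  rw [hKcomp.isClosed.mem_iff_infDist_zero hK]
  exact pow_eq_zero_iff (two_ne_zero) |>.1 (le_antisymm key (sq_nonneg _))

open MeasureTheory Set in
theorem existence_aux {E : Type*} [NormedAddCommGroup E] [NormedSpace ℝ E] [CompleteSpace E]
    (G : ℝ → E → E) (L : NNReal) (T : ℝ) (hT : 0 ≤ T) (hL : ∀ s, LipschitzWith L (G s))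
    (hint : ∀ y : ℝ → E, Continuous y → ∀ a b, IntervalIntegrable (fun s => G s (y s)) volume a b)
    (y₀ : E) :
    ∃ y : ℝ → E, Continuous y ∧
      ∀ t ∈ Icc (0:ℝ) T, y t = y₀ + ∫ s in (0:ℝ)..t, G s (y s) := by
  have hce : ∀ f : C(Icc (0:ℝ) T, E), Continuous (IccExtend hT f) := fun f => f.continuous.Icc_extend'
  let Φ : C(Icc (0:ℝ) T, E) → C(Icc (0:ℝ) T, E) := fun f =>
    ⟨fun t => y₀ + ∫ s in (0:ℝ)..t, G s (IccExtend hT f s),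
      continuous_const.add ((intervalIntegral.continuous_primitive
        (hint _ (hce f)) 0).comp continuous_subtype_val)⟩
  have hΦ : ∀ f t, Φ f t = y₀ + ∫ s in (0:ℝ)..t, G s (IccExtend hT f s) := fun _ _ => rfl
  have hbound : ∀ (n : ℕ) (f g : C(Icc (0:ℝ) T, E)) (t : Icc (0:ℝ) T),
      ‖(Φ^[n] f) t - (Φ^[n] g) t‖ ≤ (L * (t:ℝ)) ^ n / n.factorial * dist f g := by
    intro n f g
    induction n with
    | zero =>
      intro t
      simpa [dist_eq_norm] using ContinuousMap.dist_apply_le_dist (f := f) (g := g) t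
    | succ n ih =>
      intro t
      rw [Function.iterate_succ_apply', Function.iterate_succ_apply', hΦ, hΦ, add_sub_add_left_eq_sub,
        ← intervalIntegral.integral_sub (hint _ (hce _) _ _) (hint _ (hce _) _ _)]
      have hval : ∫ s in (0:ℝ)..t, (L * ((L * s) ^ n / n.factorial * dist f g)) =
          (L * (t:ℝ)) ^ (n+1) / (n+1).factorial * dist f g := by
        have : ∀ s : ℝ, (L * ((L * s) ^ n / n.factorial * dist f g)) =
            ((L:ℝ) ^ (n+1) / n.factorial * dist f g) * s ^ n := by
          intro s; rw [mul_pow]; ring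
        simp_rw [this]
        rw [intervalIntegral.integral_const_mul, integral_pow, Nat.factorial_succ, mul_pow]
        push_cast
        have : (n:ℝ) + 1 ≠ 0 := by positivity
        have : (n.factorial : ℝ) ≠ 0 := by positivity
        simp only [ne_eq, Nat.add_eq_zero_iff, one_ne_zero, and_false, not_false_eq_true, zero_pow, sub_zero]
        field_simp
      rw [← hval]
      refine intervalIntegral.norm_integral_le_of_norm_le t.2.1 (Eventually.of_forall ?_)
        (Continuous.intervalIntegrable (by fun_prop) _ _)
      intro s hs
      have hsI : s ∈ Icc 0 T := ⟨hs.1.le, hs.2.trans t.2.2⟩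
      rw [IccExtend_of_mem hT _ hsI, IccExtend_of_mem hT _ hsI, ← dist_eq_norm]
      refine ((hL s).dist_le_mul _ _).trans (mul_le_mul_of_nonneg_left ?_ L.2)
      rw [dist_eq_norm]
      exact ih ⟨s, hsI⟩
  obtain ⟨n, hn⟩ : ∃ n : ℕ, (L * T) ^ n / n.factorial < (1:ℝ) :=
    ((FloorSemiring.tendsto_pow_div_factorial_atTop ((L:ℝ) * T)).eventually_lt_const one_pos).exists
  have hnn : 0 ≤ ((L:ℝ) * T) ^ n / n.factorial := by have := L.2; positivity
  have hcontr : ContractingWith (⟨_, hnn⟩ : NNReal) Φ^[n] := by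
    refine ⟨by exact_mod_cast hn, LipschitzWith.of_dist_le_mul fun f g => ?_⟩
    rw [ContinuousMap.dist_le (by positivity)]
    intro t
    rw [dist_eq_norm]
    refine (hbound n f g t).trans ?_
    change _ ≤ ((L:ℝ) * T) ^ n / n.factorial * dist f g
    have h1 := t.2.1
    have h2 := t.2.2
    have h3 := L.2
    gcongr
  have hfix := hcontr.isFixedPt_fixedPoint_iterate
  set f := ContractingWith.fixedPoint _ hcontr
  refine ⟨IccExtend hT f, hce f, fun t ht => ?_⟩
  rw [IccExtend_of_mem hT _ ht]
  conv_lhs => rw [← hfix.eq]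
  rfl

open MeasureTheory Set in
/-- Locally Lipschitz data on a compact set can be replaced by a globally Lipschitz field. -/
theorem field_aux {E : Type*} [NormedAddCommGroup E] [NormedSpace ℝ E] [FiniteDimensional ℝ E]
    {e : ℕ} (b : E → E) (σ : E → Fin e → E)
    (hb : LocallyLipschitz b) (hσ : ∀ k, LocallyLipschitz (fun x => σ x k))
    (v : ℝ → EuclideanSpace ℝ (Fin e)) (hv : Measurable v)
    (M T : ℝ) (hT : 0 ≤ T) (hvM : ∀ t ∈ Icc (0:ℝ) T, ‖v t‖ ≤ M) (S : Set E) (hS : IsCompact S) :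
    ∃ (G : ℝ → E → E) (L : NNReal) (C₀ : ℝ), (∀ s, LipschitzWith L (G s)) ∧
      (∀ y : ℝ → E, Continuous y → ∀ a b, IntervalIntegrable (fun s => G s (y s)) volume a b) ∧
      (∀ s, ‖G s 0‖ ≤ C₀) ∧
      (∀ s ∈ Icc (0:ℝ) T, ∀ x ∈ S, G s x = b x + ∑ k, v s k • σ x k) ∧
      (∀ s, ∀ x ∈ S, ∃ c : Fin e → ℝ, G s x = b x + ∑ k, c k • σ x k) := by
  have ext : ∀ f : E → E, LocallyLipschitz f →
      ∃ (g : E → E) (L : NNReal), LipschitzWith L g ∧ EqOn f g S := by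
    intro f hf
    obtain ⟨L, hL⟩ := LocallyLipschitzOn.exists_lipschitzOnWith_of_compact hS hf.locallyLipschitzOn
    obtain ⟨g, hg, hfg⟩ := hL.extend_finite_dimension
    exact ⟨g, _, hg, hfg⟩
  obtain ⟨b', Lb, hLb, hbb⟩ := ext b hb
  choose σ' Ls hLs hσσ using fun k => ext _ (hσ k)
  have hM : 0 ≤ M := (norm_nonneg _).trans (hvM 0 ⟨le_rfl, hT⟩)
  let u : ℝ → Fin e → ℝ := fun s k => (Icc (0:ℝ) T).indicator (fun s => v s k) s
  have hu : ∀ s k, |u s k| ≤ M := by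
    intro s k
    by_cases hs : s ∈ Icc 0 T
    · simp only [u, indicator_of_mem hs]
      exact (PiLp.norm_apply_le (v s) k).trans (hvM s hs)
    · simpa [u, indicator_of_notMem hs] using hM
  have hum : ∀ k, Measurable fun s => u s k := by
    intro k
    refine Measurable.indicator ?_ measurableSet_Icc
    fun_prop
  have hui : ∀ k a b, IntervalIntegrable (fun s => u s k) volume a b := by
    intro k a b
    refine (intervalIntegrable_const (c := M)).mono_fun (hum k).aestronglyMeasurable
      (Eventually.of_forall fun s => ?_)
    simpa [abs_of_nonneg hM] using hu s k
  refine ⟨fun s x => b' x + ∑ k, u s k • σ' k x, Lb + ∑ k, M.toNNReal * Ls k,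
    ‖b' 0‖ + ∑ k, M * ‖σ' k 0‖, ?_, ?_, ?_, ?_, ?_⟩
  · intro s
    refine LipschitzWith.of_dist_le_mul fun x z => ?_
    have hb1 := hLb.dist_le_mul x z
    have hs1 : dist (∑ k, u s k • σ' k x) (∑ k, u s k • σ' k z) ≤
        ∑ k, M * Ls k * dist x z := by
      refine (dist_sum_sum_le _ _ _).trans (Finset.sum_le_sum fun k _ => ?_)
      rw [dist_smul₀, Real.norm_eq_abs, mul_assoc]
      exact mul_le_mul (hu s k) ((hLs k).dist_le_mul x z) dist_nonneg hM
    refine (dist_add_add_le _ _ _ _).trans ((add_le_add hb1 hs1).trans (le_of_eq ?_))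
    push_cast
    rw [add_mul, Finset.sum_mul, Real.coe_toNNReal _ hM]
  · intro y hy a c
    refine ((hLb.continuous.comp hy).intervalIntegrable _ _).add ?_
    have : (fun s => ∑ k, u s k • σ' k (y s)) = ∑ k, fun s => u s k • σ' k (y s) := by
      ext s; simp
    rw [this]
    refine IntervalIntegrable.sum _ fun k _ => ?_
    exact (hui k a c).smul_continuousOn ((hLs k).continuous.comp hy).continuousOn
  · intro s
    refine (norm_add_le _ _).trans (add_le_add_right ((norm_sum_le _ _).trans
      (Finset.sum_le_sum fun k _ => ?_)) _)
    rw [norm_smul]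
    exact mul_le_mul_of_nonneg_right (hu s k) (norm_nonneg _)
  · intro s hs x hx
    have h1 : ∀ k, σ' k x = σ x k := fun k => (hσσ k hx).symm
    simp only [← hbb hx, h1, u, indicator_of_mem hs]
  · intro s x hx
    have h1 : ∀ k, σ' k x = σ x k := fun k => (hσσ k hx).symm
    exact ⟨u s, by simp only [← hbb hx, h1]⟩

theorem tangent_aux {d : ℕ} (S : Set (EuclideanSpace ℝ (Fin d))) (p w δ : EuclideanSpace ℝ (Fin d))
    (hδ : δ ∈ tangentConePaper S p) (hw : ∀ q ∈ S, inner ℝ w (q - p) ≤ 0) : inner ℝ w δ ≤ 0 := by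
  obtain ⟨xn, tn, hx, ht, -, -, hlim⟩ := hδ
  refine le_of_tendsto ((tendsto_const_nhds (x := w)).inner hlim) (Eventually.of_forall fun n => ?_)
  rw [inner_smul_right]
  exact mul_nonpos_of_nonneg_of_nonpos (inv_nonneg.2 (ht n).le) (hw _ (hx n))

theorem existence_and_viability_convex_compact
    {d e : ℕ} (hd : 0 < d) (he : 0 < e) {T : ℝ} (hT : 0 < T)
    (K : Set (EuclideanSpace ℝ (Fin d))) (hK : K.Nonempty)
    (hKconv : Convex ℝ K) (hKcomp : IsCompact K)
    (b : EuclideanSpace ℝ (Fin d) → EuclideanSpace ℝ (Fin d))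
    (σ : EuclideanSpace ℝ (Fin d) → Fin e → EuclideanSpace ℝ (Fin d))
    (hb : LocallyLipschitz b) (hσ : ∀ k, LocallyLipschitz (fun x => σ x k))
    (v : ℝ → EuclideanSpace ℝ (Fin e)) (hv : Measurable v)
    (M : ℝ) (hvM : ∀ t ∈ Set.Icc (0:ℝ) T, ‖v t‖ ≤ M)
    (htan : ∀ x ∈ K, b x ∈ tangentConePaper K x ∧
      ∀ k : Fin e, σ x k ∈ tangentConePaper K x ∧ -σ x k ∈ tangentConePaper K x) :
    ∀ y₀ ∈ K,
      (∃ y : ℝ → EuclideanSpace ℝ (Fin d), ContinuousOn y (Set.Icc 0 T) ∧ y 0 = y₀ ∧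
        ∀ t ∈ Set.Icc (0:ℝ) T,
          y t = y₀ + ∫ s in (0:ℝ)..t, (b (y s) + ∑ k, v s k • σ (y s) k)) ∧
      (∀ y : ℝ → EuclideanSpace ℝ (Fin d), ContinuousOn y (Set.Icc 0 T) → y 0 = y₀ →
        (∀ t ∈ Set.Icc (0:ℝ) T,
          y t = y₀ + ∫ s in (0:ℝ)..t, (b (y s) + ∑ k, v s k • σ (y s) k)) →
        ∀ t ∈ Set.Icc (0:ℝ) T, y t ∈ K) := by
  intro y₀ hy₀
  have normal : ∀ (G : ℝ → EuclideanSpace ℝ (Fin d) → EuclideanSpace ℝ (Fin d)),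
      (∀ s, ∀ x ∈ K, ∃ c : Fin e → ℝ, G s x = b x + ∑ k, c k • σ x k) →
      ∀ s, ∀ p ∈ K, ∀ w : EuclideanSpace ℝ (Fin d), (∀ q ∈ K, inner ℝ w (q - p) ≤ 0) →
        inner ℝ w (G s p) ≤ 0 := by
    intro G hG s p hp w hw
    obtain ⟨c, hc⟩ := hG s p hp
    obtain ⟨h1, h2⟩ := htan p hp
    rw [hc, inner_add_right, inner_sum]
    have hz : ∀ k, inner ℝ w (c k • σ p k) = 0 := by
      intro k
      have e1 := tangent_aux K p w _ (h2 k).1 hw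
      have e2 := tangent_aux K p w _ (h2 k).2 hw
      rw [inner_neg_right] at e2
      rw [inner_smul_right, le_antisymm e1 (by linarith), mul_zero]
    simp only [hz, Finset.sum_const_zero, add_zero]
    exact tangent_aux K p w _ h1 hw
  constructor
  · obtain ⟨G, L, C₀, hL, hint, hC₀, hG, hG'⟩ :=
      field_aux b σ hb hσ v hv M T hT.le hvM K hKcomp
    obtain ⟨y, hy, hsol⟩ := existence_aux G L T hT.le hL hint y₀
    have hyK := viability_aux G L C₀ T hL hint hC₀ K hKconv hK hKcomp (normal G hG') y hy y₀ hy₀ hsol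
    refine ⟨y, hy.continuousOn, by simpa using hsol 0 ⟨le_rfl, hT.le⟩, fun t ht => ?_⟩
    rw [hsol t ht]
    congr 1
    refine intervalIntegral.integral_congr fun s hs => ?_
    rw [Set.uIcc_of_le ht.1] at hs
    have hsI : s ∈ Set.Icc 0 T := ⟨hs.1, hs.2.trans ht.2⟩
    exact hG s hsI _ (hyK s hsI)
  · intro y hyc _ hsol
    obtain ⟨G, L, C₀, hL, hint, hC₀, hG, hG'⟩ :=
      field_aux b σ hb hσ v hv M T hT.le hvM (K ∪ y '' Set.Icc 0 T)
        (hKcomp.union (isCompact_Icc.image_of_continuousOn hyc))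
    set y' := Set.IccExtend hT.le ((Set.Icc 0 T).domRestrict y) with hy'
    have heq : ∀ t ∈ Set.Icc 0 T, y' t = y t := by
      intro t ht
      rw [hy', Set.IccExtend_of_mem _ _ ht]; rfl
    have hcont : Continuous y' := (continuousOn_iff_continuous_domRestrict.1 hyc).Icc_extend'
    intro t ht
    rw [← heq t ht]
    refine viability_aux G L C₀ T hL hint hC₀ K hKconv hK hKcomp
      (normal G fun s x hx => hG' s x (Or.inl hx)) y' hcont y₀ hy₀ ?_ t ht
    intro t ht
    rw [heq t ht, hsol t ht]
    congr 1
    refine intervalIntegral.integral_congr fun s hs => ?_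
    rw [Set.uIcc_of_le ht.1] at hs
    have hsI : s ∈ Set.Icc 0 T := ⟨hs.1, hs.2.trans ht.2⟩
    simp only
    rw [heq s hsI, hG s hsI _ (Or.inr ⟨s, hsI, rfl⟩)]
end
end
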